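/- arXiv:2102.09201 — 2 statements merged into one kernel-verified Lean document; each statement's English description precedes it below -/
import Mathlib

section
/- Let α > 0 and define g : ℝ → ℂ by g(x) = ∫₀^∞ t^(α−1) e^(−t²/2) e^(ixt) dt. Then g is twice differentiable on ℝ and satisfies g″(x) + x g′(x) + α g(x) = 0 for all x ∈ ℝ. -/
open MeasureTheory Set Filter Topology

/-- The integrand `t ^ s * exp (-t² / 2) * exp (i x t)`. -/
noncomputable def gaussianMellinKernel (s x t : ℝ) : ℂ :=
  (t : ℂ) ^ (s : ℂ) * Complex.exp (-(t : ℂ) ^ 2 / 2) *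
    Complex.exp (Complex.I * (x : ℂ) * (t : ℂ))

lemma norm_gaussianMellinKernel (s x : ℝ) {t : ℝ} (ht : 0 < t) :
    ‖gaussianMellinKernel s x t‖ = t ^ s * Real.exp (-(1 / 2) * t ^ 2) := by
  have h₁ : -(t : ℂ) ^ 2 / 2 = ((-(1 / 2) * t ^ 2 : ℝ) : ℂ) := by push_cast; ring
  have h₂ : Complex.I * (x : ℂ) * (t : ℂ) = ((x * t : ℝ) : ℂ) * Complex.I := by
    push_cast; ring
  rw [gaussianMellinKernel, norm_mul, norm_mul, h₁, h₂, Complex.norm_exp_ofReal_mul_I,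
    Complex.norm_cpow_eq_rpow_re_of_pos ht, ← Complex.ofReal_exp,
    Complex.norm_of_nonneg (Real.exp_pos _).le, Complex.ofReal_re, mul_one]

lemma gaussianMellinKernel_add_one (s x : ℝ) {t : ℝ} (ht : 0 < t) :
    gaussianMellinKernel (s + 1) x t = t * gaussianMellinKernel s x t := by
  have ht' : (t : ℂ) ≠ 0 := by exact_mod_cast ht.ne'
  rw [gaussianMellinKernel, gaussianMellinKernel, Complex.ofReal_add, Complex.ofReal_one,
    Complex.cpow_add _ _ ht', Complex.cpow_one]
  ring

lemma measurable_gaussianMellinKernel (s x : ℝ) : Measurable (gaussianMellinKernel s x) := by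
  unfold gaussianMellinKernel
  fun_prop

lemma integrableOn_rpow_mul_exp_neg_half_sq {s : ℝ} (hs : -1 < s) :
    IntegrableOn (fun t : ℝ => t ^ s * Real.exp (-(1 / 2) * t ^ 2)) (Ioi 0) :=
  integrableOn_rpow_mul_exp_neg_mul_sq one_half_pos hs

lemma integrableOn_gaussianMellinKernel {s : ℝ} (hs : -1 < s) (x : ℝ) :
    IntegrableOn (gaussianMellinKernel s x) (Ioi 0) := by
  refine (integrableOn_rpow_mul_exp_neg_half_sq hs).mono'
    (measurable_gaussianMellinKernel s x).aestronglyMeasurable ?_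
  filter_upwards [ae_restrict_mem measurableSet_Ioi] with t ht
  exact (norm_gaussianMellinKernel s x ht).le

lemma hasDerivAt_gaussianMellinKernel_param (s x : ℝ) {t : ℝ} (ht : 0 < t) :
    HasDerivAt (fun y => gaussianMellinKernel s y t)
      (Complex.I * gaussianMellinKernel (s + 1) x t) x := by
  have h : HasDerivAt (fun y : ℝ => Complex.I * (y : ℂ) * (t : ℂ)) (Complex.I * t) x := by
    simpa using ((Complex.ofRealCLM.hasDerivAt (x := x)).const_mul Complex.I).mul_const (t : ℂ)
  rw [gaussianMellinKernel_add_one s x ht]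
  refine (h.cexp.const_mul ((t : ℂ) ^ (s : ℂ) * Complex.exp (-(t : ℂ) ^ 2 / 2))).congr_deriv ?_
  rw [gaussianMellinKernel]
  ring

lemma hasDerivAt_integral_gaussianMellinKernel {s : ℝ} (hs : -1 < s) (x : ℝ) :
    HasDerivAt (fun y => ∫ t in Ioi (0 : ℝ), gaussianMellinKernel s y t)
      (Complex.I * ∫ t in Ioi (0 : ℝ), gaussianMellinKernel (s + 1) x t) x := by
  rw [← integral_const_mul]
  refine (hasDerivAt_integral_of_dominated_loc_of_deriv_le
    (F' := fun y t => Complex.I * gaussianMellinKernel (s + 1) y t)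
    (bound := fun t => t ^ (s + 1) * Real.exp (-(1 / 2) * t ^ 2)) univ_mem
    (.of_forall fun y => (measurable_gaussianMellinKernel s y).aestronglyMeasurable)
    (integrableOn_gaussianMellinKernel hs x)
    ((measurable_gaussianMellinKernel (s + 1) x).const_mul _).aestronglyMeasurable ?_
    (integrableOn_rpow_mul_exp_neg_half_sq (by linarith)) ?_).2
  · filter_upwards [ae_restrict_mem measurableSet_Ioi] with t ht y _
    rw [norm_mul, Complex.norm_I, one_mul, norm_gaussianMellinKernel _ _ ht]
  · filter_upwards [ae_restrict_mem measurableSet_Ioi] with t ht y _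
    exact hasDerivAt_gaussianMellinKernel_param s y ht

lemma hasDerivAt_gaussianMellinKernel (s x : ℝ) {t : ℝ} (ht : 0 < t) :
    HasDerivAt (gaussianMellinKernel (s + 1) x)
      ((s + 1) * gaussianMellinKernel s x t - gaussianMellinKernel (s + 1 + 1) x t
        + Complex.I * x * gaussianMellinKernel (s + 1) x t) t := by
  have hid : HasDerivAt (fun u : ℝ => (u : ℂ)) 1 t := Complex.ofRealCLM.hasDerivAt
  have hpow : HasDerivAt (fun u : ℝ => (u : ℂ) ^ ((s + 1 : ℝ) : ℂ))
      ((s + 1) * (t : ℂ) ^ (s : ℂ)) t := by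
    refine (((hasDerivAt_id (t : ℂ)).cpow_const (c := ((s + 1 : ℝ) : ℂ))
      (Complex.ofReal_mem_slitPlane.2 ht)).comp_ofReal).congr_deriv ?_
    simp
  have hsq : HasDerivAt (fun u : ℝ => -(u : ℂ) ^ 2 / 2) (-(t : ℂ)) t :=
    ((hid.pow 2).neg.div_const (2 : ℂ)).congr_deriv (by simp; ring)
  have hlin : HasDerivAt (fun u : ℝ => Complex.I * (x : ℂ) * (u : ℂ)) (Complex.I * x) t := by
    simpa using hid.const_mul (Complex.I * (x : ℂ))
  refine ((hpow.mul hsq.cexp).mul hlin.cexp).congr_deriv ?_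
  rw [gaussianMellinKernel_add_one (s + 1) x ht]
  simp only [gaussianMellinKernel, Pi.mul_apply]
  ring

lemma tendsto_gaussianMellinKernel_atTop (s x : ℝ) :
    Tendsto (gaussianMellinKernel s x) atTop (𝓝 0) := by
  have h : Tendsto (fun t : ℝ => Real.exp (-(1 / 2) * t)) atTop (𝓝 0) :=
    Real.tendsto_exp_atBot.comp (tendsto_id.const_mul_atTop_of_neg (by norm_num))
  rw [tendsto_zero_iff_norm_tendsto_zero]
  refine ((rpow_mul_exp_neg_mul_sq_isLittleO_exp_neg one_half_pos s).trans_tendsto h).congr' ?_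
  filter_upwards [eventually_gt_atTop 0] with t ht
  exact (norm_gaussianMellinKernel s x ht).symm

lemma continuousAt_gaussianMellinKernel_zero {s : ℝ} (hs : 0 < s) (x : ℝ) :
    ContinuousAt (gaussianMellinKernel s x) 0 := by
  have h : ContinuousAt (fun t : ℝ => (t : ℂ) ^ (s : ℂ)) 0 :=
    Complex.continuousAt_ofReal_cpow_const 0 s (Or.inl (by simpa using hs))
  exact (h.mul (by fun_prop)).mul (by fun_prop)

/-- Integration by parts: the boundary terms of `t ^ (s + 1) * exp (-t² / 2) * exp (i x t)`
vanish. -/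
lemma integral_gaussianMellinKernel_recurrence {s : ℝ} (hs : -1 < s) (x : ℝ) :
    (s + 1) * (∫ t in Ioi (0 : ℝ), gaussianMellinKernel s x t)
      - (∫ t in Ioi (0 : ℝ), gaussianMellinKernel (s + 1 + 1) x t)
      + Complex.I * x * (∫ t in Ioi (0 : ℝ), gaussianMellinKernel (s + 1) x t) = 0 := by
  have h₀ := (integrableOn_gaussianMellinKernel hs x).const_mul ((s : ℂ) + 1)
  have h₁ := (integrableOn_gaussianMellinKernel (s := s + 1) (by linarith) x).const_mul
    (Complex.I * x)
  have h₂ := integrableOn_gaussianMellinKernel (s := s + 1 + 1) (by linarith) x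
  have hzero : gaussianMellinKernel (s + 1) x 0 = 0 := by
    have : ((s + 1 : ℝ) : ℂ) ≠ 0 := by
      rw [Complex.ofReal_ne_zero]
      linarith
    rw [gaussianMellinKernel, Complex.ofReal_zero, Complex.zero_cpow this, zero_mul, zero_mul]
  have h₀₂ : Integrable (fun t => (s + 1) * gaussianMellinKernel s x t
      - gaussianMellinKernel (s + 1 + 1) x t) (volume.restrict (Ioi 0)) := h₀.sub h₂
  have key := integral_Ioi_of_hasDerivAt_of_tendsto
    (continuousAt_gaussianMellinKernel_zero (by linarith) x).continuousWithinAt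
    (fun t ht => hasDerivAt_gaussianMellinKernel s x ht) (h₀₂.add h₁)
    (tendsto_gaussianMellinKernel_atTop (s + 1) x)
  rw [hzero, sub_zero] at key
  rw [← key, integral_add h₀₂ h₁, integral_sub h₀ h₂, integral_const_mul,
    integral_const_mul]

open Complex in
/-- The function `g(x) = ∫₀^∞ t^{α−1} e^{−t²/2} e^{ixt} dt` (a multiple of
`e^{−x²/4} D_{−α}(ix)`) solves the linearised Gaussian high-temperature loop
equation `g″ + x g′ + α g = 0`. -/
theorem parabolic_cylinder_integral_solves_ode (α : ℝ) (hα : 0 < α)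
    (g : ℝ → ℂ)
    (hg : ∀ x : ℝ, g x = ∫ t in Set.Ioi (0 : ℝ),
      (t : ℂ) ^ ((α : ℂ) - 1) * Complex.exp (-(t : ℂ) ^ 2 / 2) *
        Complex.exp (Complex.I * (x : ℂ) * (t : ℂ))) :
    ∃ g' g'' : ℝ → ℂ,
      (∀ x : ℝ, HasDerivAt g (g' x) x) ∧
      (∀ x : ℝ, HasDerivAt g' (g'' x) x) ∧
      (∀ x : ℝ, g'' x + (x : ℂ) * g' x + (α : ℂ) * g x = 0) := by
  have hs : -1 < α - 1 := by linarith
  have hg' : g = fun x => ∫ t in Ioi (0 : ℝ), gaussianMellinKernel (α - 1) x t := by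
    funext x
    simp only [hg, gaussianMellinKernel, Complex.ofReal_sub, Complex.ofReal_one]
  refine ⟨fun x => I * ∫ t in Ioi (0 : ℝ), gaussianMellinKernel (α - 1 + 1) x t,
    fun x => I * (I * ∫ t in Ioi (0 : ℝ), gaussianMellinKernel (α - 1 + 1 + 1) x t),
    fun x => ?_, fun x => ?_, fun x => ?_⟩
  · rw [hg']
    exact hasDerivAt_integral_gaussianMellinKernel hs x
  · exact (hasDerivAt_integral_gaussianMellinKernel (by linarith) x).const_mul I
  · have h := integral_gaussianMellinKernel_recurrence hs x
    rw [ofReal_sub, ofReal_one, sub_add_cancel] at h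
    rw [hg', ← h]
    linear_combination (∫ t in Ioi (0 : ℝ), gaussianMellinKernel (α - 1 + 1 + 1) x t) * I_mul_I
end

section
/- Let α ∈ ℝ, let W : ℝ → ℝ be twice continuously differentiable, and let F : ℝ × ℝ → ℝ be continuously differentiable and symmetric, F(x₁,x₂) = F(x₂,x₁) for all x₁, x₂. Suppose that for all x₁ ≠ x₂: −∂F/∂x₁(x₁,x₂) − x₁ F(x₁,x₂) + ∂/∂x₂[(W(x₁) − W(x₂))/(x₁ − x₂)] + 2α W(x₁) F(x₁,x₂) = 0. Then for every x ∈ ℝ: −(1/2) (d/dx)[F(x,x)] − x F(x,x) + (1/2) W″(x) + 2α W(x) F(x,x) = 0. -/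
open Filter Topology in
/-- Fixing one node, the second-order divided difference of a function that is differentiable
near `a` tends to half of its second derivative at `a`. -/
theorem tendsto_taylor_quotient_nhdsNE {f : ℝ → ℝ} {f₂ a : ℝ} (hf : Differentiable ℝ f)
    (hf₂ : HasDerivAt (deriv f) f₂ a) :
    Tendsto (fun t => (f t - f a - deriv f a * (t - a)) / (t - a) ^ 2) (𝓝[≠] a) (𝓝 (f₂ / 2)) := by
  have num_deriv (t : ℝ) :
      HasDerivAt (fun t => f t - f a - deriv f a * (t - a)) (deriv f t - deriv f a) t := by
    simpa using ((hf t).hasDerivAt.sub_const (f a)).fun_sub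
      (((hasDerivAt_id t).sub_const a).const_mul (deriv f a))
  have den_deriv (t : ℝ) : HasDerivAt (fun t => (t - a) ^ 2) (2 * (t - a)) t := by
    simpa using ((hasDerivAt_id t).sub_const a).fun_pow 2
  refine HasDerivAt.lhopital_zero_nhdsNE (.of_forall num_deriv) (.of_forall den_deriv) ?_ ?_ ?_ ?_
  · filter_upwards [self_mem_nhdsWithin] with t ht
    exact mul_ne_zero two_ne_zero (sub_ne_zero.2 ht)
  · simpa using (num_deriv a).continuousAt.tendsto.mono_left nhdsWithin_le_nhds
  · simpa using (den_deriv a).continuousAt.tendsto.mono_left nhdsWithin_le_nhds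
  · refine ((hasDerivAt_iff_tendsto_slope.1 hf₂).div_const 2).congr fun t => ?_
    rw [slope_def_field, div_div, mul_comm]

theorem deriv_divided_difference {f : ℝ → ℝ} {s t : ℝ} (hf : DifferentiableAt ℝ f t)
    (hst : s ≠ t) :
    deriv (fun y => (f s - f y) / (s - y)) t = (f s - f t - deriv f t * (s - t)) / (s - t) ^ 2 := by
  have h := (hf.hasDerivAt.const_sub (f s)).fun_div ((hasDerivAt_id' t).const_sub s)
    (sub_ne_zero.2 hst)
  rw [h.deriv]
  ring

/-- The partial derivative of a `C¹` function of two variables is continuous. -/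
theorem continuous_deriv_left {F : ℝ → ℝ → ℝ} (hF : ContDiff ℝ 1 (fun p : ℝ × ℝ => F p.1 p.2))
    (x : ℝ) : Continuous (deriv fun y => F y x) :=
  ContDiff.continuous_deriv (n := 1)
    (hF.comp (contDiff_id.prodMk contDiff_const)) le_rfl

theorem deriv_diagonal_of_symm {F : ℝ → ℝ → ℝ} {x : ℝ}
    (hF : DifferentiableAt ℝ (fun p : ℝ × ℝ => F p.1 p.2) (x, x))
    (hFsymm : ∀ x₁ x₂ : ℝ, F x₁ x₂ = F x₂ x₁) :
    deriv (fun y => F y y) x = 2 * deriv (fun y => F y x) x := by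
  have id_deriv := hasDerivAt_id' x
  have const_deriv := hasDerivAt_const x x
  have diag := hF.hasFDerivAt.comp_hasDerivAt (f := fun y => (y, y)) x (id_deriv.prodMk id_deriv)
  have left := hF.hasFDerivAt.comp_hasDerivAt (f := fun y => (y, x)) x (id_deriv.prodMk const_deriv)
  have right := hF.hasFDerivAt.comp_hasDerivAt (f := fun y => (x, y)) x (const_deriv.prodMk id_deriv)
  have swap : (fun y => F y x) = fun y => F x y := funext fun y => hFsymm y x
  calc deriv (fun y => F y y) x
      = deriv (fun y => F y x) x + deriv (fun y => F x y) x := by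
        refine diag.deriv.trans ?_
        refine Eq.trans ?_ (congrArg₂ (· + ·) left.deriv right.deriv).symm
        simp only [← map_add, Prod.mk_add_mk, add_zero, zero_add]
    _ = 2 * deriv (fun y => F y x) x := by rw [← swap, two_mul]

/-- Coincident-point limit of the second Gaussian loop equation at leading order:
if the symmetric `C¹` function `F` and the `C²` function `W` satisfy the off-diagonal
equation, then on the diagonal
`−(1/2)(d/dx)F(x,x) − xF(x,x) + (1/2)W″(x) + 2αW(x)F(x,x) = 0`. -/
theorem gaussian_second_loop_coincident_limit (α : ℝ)
    (W : ℝ → ℝ) (hW : ContDiff ℝ 2 W)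
    (F : ℝ → ℝ → ℝ) (hF : ContDiff ℝ 1 (fun p : ℝ × ℝ => F p.1 p.2))
    (hFsymm : ∀ x₁ x₂ : ℝ, F x₁ x₂ = F x₂ x₁)
    (heq : ∀ x₁ x₂ : ℝ, x₁ ≠ x₂ →
      -(deriv (fun y => F y x₂) x₁) - x₁ * F x₁ x₂ +
        deriv (fun y => (W x₁ - W y) / (x₁ - y)) x₂ +
        2 * α * W x₁ * F x₁ x₂ = 0) :
    ∀ x : ℝ,
      -(1 / 2) * deriv (fun y => F y y) x - x * F x x +
        (1 / 2) * deriv (deriv W) x + 2 * α * W x * F x x = 0 := by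
  intro x
  have hW₂ : HasDerivAt (deriv W) (deriv (deriv W) x) x :=
    (ContDiff.differentiable (n := 1) (hW.iterate_deriv' 1 1) one_ne_zero x).hasDerivAt
  have quotient_tendsto :=
    tendsto_taylor_quotient_nhdsNE (hW.differentiable two_ne_zero) hW₂
  have F_cont : Continuous fun t => F t x := hF.continuous.comp (by fun_prop : Continuous (·, x))
  have rest_cont : Continuous fun t =>
      -(deriv (fun y => F y x) t) - t * F t x + 2 * α * W t * F t x :=
    (((continuous_deriv_left hF x).neg.sub (continuous_id.mul F_cont))).add
      ((continuous_const.mul hW.continuous).mul F_cont)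
  have limit := ((rest_cont.tendsto x).mono_left nhdsWithin_le_nhds).add quotient_tendsto
  have vanishes : ∀ᶠ t in nhdsWithin x {x}ᶜ,
      -(deriv (fun y => F y x) t) - t * F t x + 2 * α * W t * F t x +
        (W t - W x - deriv W x * (t - x)) / (t - x) ^ 2 = 0 := by
    filter_upwards [self_mem_nhdsWithin] with t ht
    rw [← deriv_divided_difference (hW.differentiable two_ne_zero x) ht]
    linarith [heq t x ht]
  have eq_zero := tendsto_nhds_unique_of_eventuallyEq limit tendsto_const_nhds vanishes
  rw [deriv_diagonal_of_symm (hF.differentiable one_ne_zero (x, x)) hFsymm]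
  linarith
end
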